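/- arXiv:quant-ph/0205139 — 5 statements merged into one kernel-verified Lean document; each statement's English description precedes it below -/
import Mathlib

section
/- Fix an integer d ≥ 2 and let L_d = {0, 1/(d−1), …, 1}. For k ∈ L_d define j_k : L_d → L_d by j_k(x) = 1 if x = k and 0 otherwise, and for n-tuples x, c ∈ L_d^n define M(x,c) := min_{1≤i≤n} j_{c_i}(x_i). Then for every function f : L_d^n → L_d and every x ∈ L_d^n, f(x₁,…,x_n) = min over all c ∈ L_d^n with f(c) ≠ 1 of ( M(x,c) →_L f(c) ), where a →_L b = min(1, 1 − a + b) and the minimum over an empty index set is taken to be 1. (Clay's representation.) -/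
/-- The set of truth values `L_d = {0, 1/(d-1), …, 1}` as a finite set of reals. -/
noncomputable def Ld (d : ℕ) : Finset ℝ :=
  (Finset.range d).image (fun k : ℕ => (k : ℝ) / ((d : ℝ) - 1))

/-- `j_k(x) = 1` if `x = k`, `0` otherwise. -/
noncomputable def jFun (k x : ℝ) : ℝ := if x = k then 1 else 0

/-- `M(x,c) = min_{1 ≤ i ≤ n} j_{c i}(x i)`. -/
noncomputable def MFun {n : ℕ} (x c : Fin n → ℝ) : ℝ :=
  Finset.univ.fold min 1 (fun i => jFun (c i) (x i))

/-- The Łukasiewicz implication `a →_L b = min 1 (1 - a + b)`. -/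
noncomputable def lukImp (a b : ℝ) : ℝ := min 1 (1 - a + b)

theorem MFun_self {n : ℕ} (x : Fin n → ℝ) : MFun x x = 1 := by
  refine le_antisymm ((Finset.fold_min_le _).2 (Or.inl le_rfl)) ?_
  exact (Finset.le_fold_min _).2 ⟨le_rfl, fun i _ => by simp [jFun]⟩

theorem MFun_nonpos_of_ne {n : ℕ} {x c : Fin n → ℝ} (h : x ≠ c) : MFun x c ≤ 0 := by
  obtain ⟨i, hi⟩ := Function.ne_iff.1 h
  exact (Finset.fold_min_le _).2 (Or.inr ⟨i, Finset.mem_univ i, by simp [jFun, hi]⟩)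

theorem mem_Icc_of_mem_Ld {d : ℕ} (hd : 2 ≤ d) {y : ℝ} (hy : y ∈ Ld d) :
    y ∈ Set.Icc (0 : ℝ) 1 := by
  obtain ⟨k, hk, rfl⟩ := Finset.mem_image.1 hy
  have hkd : (k : ℝ) + 1 ≤ d := by exact_mod_cast Finset.mem_range.1 hk
  have hd' : (2 : ℝ) ≤ d := by exact_mod_cast hd
  exact ⟨div_nonneg k.cast_nonneg (by linarith), div_le_one_of_le₀ (by linarith) (by linarith)⟩

theorem lukImp_one_left {b : ℝ} (hb : b ≤ 1) : lukImp 1 b = b := by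
  simp [lukImp, hb]

theorem lukImp_eq_one_of_le {a b : ℝ} (h : a ≤ b) : lukImp a b = 1 :=
  min_eq_left (by linarith)

theorem stmt_8 (d n : ℕ) (hd : 2 ≤ d) (hn : 0 < n)
    (f : (Fin n → ℝ) → ℝ)
    (hf : ∀ x : Fin n → ℝ, (∀ i, x i ∈ Ld d) → f x ∈ Ld d)
    (x : Fin n → ℝ) (hx : ∀ i, x i ∈ Ld d) :
    f x = ((Fintype.piFinset (fun _ : Fin n => Ld d)).filter
        (fun c => f c ≠ 1)).fold min 1 (fun c => lukImp (MFun x c) (f c)) := by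
  have hfx := mem_Icc_of_mem_Ld hd (hf x hx)
  apply le_antisymm
  · refine (Finset.le_fold_min _).2 ⟨hfx.2, fun c hc => ?_⟩
    rcases eq_or_ne x c with rfl | hxc
    · rw [MFun_self, lukImp_one_left hfx.2]
    · have hc' := Fintype.mem_piFinset.1 (Finset.mem_filter.1 hc).1
      have hfc := mem_Icc_of_mem_Ld hd (hf c hc')
      rw [lukImp_eq_one_of_le ((MFun_nonpos_of_ne hxc).trans hfc.1)]
      exact hfx.2
  · refine (Finset.fold_min_le _).2 ?_
    by_cases h : f x = 1
    · exact Or.inl h.ge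
    · refine Or.inr ⟨x, Finset.mem_filter.2 ⟨Fintype.mem_piFinset.2 hx, h⟩, ?_⟩
      rw [MFun_self, lukImp_one_left hfx.2]
end

section
/- Let n and d be integers with 0 < n ≤ d and let L_d = {0, 1/(d−1), …, 1}. Then there is no function f : L_d^n → L_d^n that is strictly conservative (for every input tuple, the multiset of the n output values equals the multiset of the n input values) and realizes the FAN-OUT function in one of its configurations; i.e., there do not exist an input position i, constants c_t ∈ L_d for every position t ≠ i, and two distinct output positions j ≠ j', such that for every a ∈ L_d, feeding a at position i and the constants c_t at the other positions yields outputs whose j-th and j'-th components both equal a. -/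
theorem card_Ld {d : ℕ} (hd : 2 ≤ d) : (Ld d).card = d := by
  have hpos : (0 : ℝ) < (d : ℝ) - 1 := by
    have : (2 : ℝ) ≤ d := by exact_mod_cast hd
    linarith
  rw [Ld, Finset.card_image_of_injective, Finset.card_range]
  intro a b hab
  exact_mod_cast (div_left_inj' hpos.ne').mp hab

theorem card_filter_eq_of_map_eq {ι α : Type*} [Fintype ι] [DecidableEq α] {x y : ι → α}
    (h : Multiset.map x Finset.univ.val = Multiset.map y Finset.univ.val) (a : α) :
    (Finset.univ.filter fun t => a = x t).card = (Finset.univ.filter fun t => a = y t).card := by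
  have := congrArg (Multiset.count a) h
  rwa [Multiset.count_map, Multiset.count_map] at this

theorem stmt_9 (n d : ℕ) (hn : 0 < n) (hnd : n ≤ d) (hd : 2 ≤ d) :
    ¬ ∃ (f : (Fin n → ℝ) → (Fin n → ℝ)) (i : Fin n) (c : Fin n → ℝ) (j j' : Fin n),
      j ≠ j' ∧
      (∀ t, t ≠ i → c t ∈ Ld d) ∧
      -- strict conservativeness: the multiset of outputs equals the multiset of inputs
      (∀ x : Fin n → ℝ, (∀ t, x t ∈ Ld d) →
        Multiset.map (f x) Finset.univ.val = Multiset.map x Finset.univ.val) ∧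
      -- the configuration realizes FAN-OUT: outputs j and j' both copy input i
      (∀ a ∈ Ld d, f (Function.update c i a) j = a ∧ f (Function.update c i a) j' = a) := by
  rintro ⟨f, i, c, j, j', hjj, hc, hf, hfan⟩
  obtain ⟨a, ha, hac⟩ : ∃ a ∈ Ld d, a ∉ (Finset.univ.erase i).image c := by
    apply Finset.exists_mem_notMem_of_card_lt_card
    have h : ((Finset.univ.erase i).image c).card ≤ (Finset.univ.erase i).card :=
      Finset.card_image_le
    rw [Finset.card_erase_of_mem (Finset.mem_univ i), Finset.card_univ, Fintype.card_fin] at h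
    rw [card_Ld hd]
    omega
  have hx : ∀ t, Function.update c i a t ∈ Ld d := by
    intro t
    by_cases ht : t = i
    · simpa [ht] using ha
    · simpa [ht] using hc t ht
  have hcount := card_filter_eq_of_map_eq (hf _ hx) a
  have hin : (Finset.univ.filter fun t => a = Function.update c i a t).card ≤ 1 := by
    have : Nonempty (Fin n) := ⟨i⟩
    rw [Finset.card_le_one_iff_subset_singleton]
    refine ⟨i, fun t ht => ?_⟩
    by_contra hti
    rw [Finset.mem_singleton] at hti
    rw [Finset.mem_filter, Function.update_of_ne hti] at ht
    exact hac (Finset.mem_image.mpr ⟨t, by simp [hti], ht.2.symm⟩)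
  have hout : 1 < (Finset.univ.filter fun t => a = f (Function.update c i a) t).card :=
    Finset.one_lt_card.mpr ⟨j, by simp [(hfan a ha).1], j', by simp [(hfan a ha).2], hjj⟩
  omega
end

section
/- Fix an integer d ≥ 2, let L_d = {0, 1/(d−1), …, 1}, and let f¹_d : L_d^3 → L_d^3 be defined by the first applicable of the following rules: i) (x₁,x₃,x₂) if x₁ = 0 and x₂ ≠ x₃; ii) (x₁,x₃,x₂) if 0 < x₁ ≤ x₃ < 1 and x₂ = 1; iii) (x₁,x₃,x₂) if 0 < x₁ ≤ x₂ < 1 and x₃ = 1; iv) (x₁,x₁,1−x₁+x₃) if x₃ < x₁ < 1 and x₂ = 1; v) (x₁,1,x₃+x₁−1) if x₁ < 1, x₂ = x₁, x₃+x₁ ≥ 1 and x₃ < 1; vi) (x₁,x₁,x₂−x₁) if 0 < x₁ < x₂ < 1 and x₃ = 0; vii) (x₁,x₃+x₁,0) if 0 < x₁, x₂ = x₁, x₃+x₁ < 1 and x₃ > 0; viii) (x₁,x₂,x₃) otherwise. Then f¹_d is self-reversible: f¹_d(f¹_d(x)) = x for every x ∈ L_d^3 (in particular, f¹_d is a bijection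 of L_d^3). -/
/-- The gate `f¹_d`, defined by the first applicable of rules i) – viii). -/
noncomputable def f1 (x : ℝ × ℝ × ℝ) : ℝ × ℝ × ℝ :=
  let x₁ := x.1; let x₂ := x.2.1; let x₃ := x.2.2
  if x₁ = 0 ∧ x₂ ≠ x₃ then (x₁, x₃, x₂)                                      -- i)
  else if 0 < x₁ ∧ x₁ ≤ x₃ ∧ x₃ < 1 ∧ x₂ = 1 then (x₁, x₃, x₂)               -- ii)
  else if 0 < x₁ ∧ x₁ ≤ x₂ ∧ x₂ < 1 ∧ x₃ = 1 then (x₁, x₃, x₂)               -- iii)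
  else if x₃ < x₁ ∧ x₁ < 1 ∧ x₂ = 1 then (x₁, x₁, 1 - x₁ + x₃)               -- iv)
  else if x₁ < 1 ∧ x₂ = x₁ ∧ 1 ≤ x₃ + x₁ ∧ x₃ < 1 then (x₁, 1, x₃ + x₁ - 1)  -- v)
  else if 0 < x₁ ∧ x₁ < x₂ ∧ x₂ < 1 ∧ x₃ = 0 then (x₁, x₁, x₂ - x₁)          -- vi)
  else if 0 < x₁ ∧ x₂ = x₁ ∧ x₃ + x₁ < 1 ∧ 0 < x₃ then (x₁, x₃ + x₁, 0)      -- vii)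
  else (x₁, x₂, x₃)                                                           -- viii)

theorem f1_f1_of_mem_Icc {a b c : ℝ} (ha : a ∈ Set.Icc 0 1) (hb : b ∈ Set.Icc 0 1)
    (hc : c ∈ Set.Icc 0 1) : f1 (f1 (a, b, c)) = (a, b, c) := by
  obtain ⟨ha₀, ha₁⟩ := ha
  obtain ⟨hb₀, hb₁⟩ := hb
  obtain ⟨hc₀, hc₁⟩ := hc
  rw [f1.eq_def (a, b, c)]
  dsimp only
  split_ifs <;> unfold f1 <;> dsimp only <;> grind (splits := 20)

theorem Ld_subset_Icc {d : ℕ} (hd : 2 ≤ d) {x : ℝ} (hx : x ∈ Ld d) : x ∈ Set.Icc 0 1 := by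
  simp only [Ld, Finset.mem_image, Finset.mem_range] at hx
  obtain ⟨k, hk, rfl⟩ := hx
  have hd' : (2 : ℝ) ≤ d := by exact_mod_cast hd
  have hk' : (k : ℝ) + 1 ≤ d := by exact_mod_cast hk
  exact ⟨div_nonneg k.cast_nonneg (by linarith), (div_le_one (by linarith)).2 (by linarith)⟩

theorem zero_mem_Ld {d : ℕ} (hd : 2 ≤ d) : (0 : ℝ) ∈ Ld d :=
  Finset.mem_image.2 ⟨0, by simp; omega, by simp⟩

theorem one_mem_Ld {d : ℕ} (hd : 2 ≤ d) : (1 : ℝ) ∈ Ld d := by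
  have hd' : (2 : ℝ) ≤ d := by exact_mod_cast hd
  refine Finset.mem_image.2 ⟨d - 1, by simp; omega, ?_⟩
  rw [Nat.cast_sub (by omega), Nat.cast_one]
  exact div_self (by linarith)

theorem add_sub_mem_Ld {d : ℕ} (hd : 2 ≤ d) {x y z : ℝ} (hx : x ∈ Ld d) (hy : y ∈ Ld d)
    (hz : z ∈ Ld d) (h₀ : 0 ≤ x + y - z) (h₁ : x + y - z ≤ 1) : x + y - z ∈ Ld d := by
  simp only [Ld, Finset.mem_image, Finset.mem_range] at hx hy hz ⊢
  obtain ⟨k, -, rfl⟩ := hx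
  obtain ⟨l, -, rfl⟩ := hy
  obtain ⟨m, -, rfl⟩ := hz
  have hd' : (2 : ℝ) ≤ d := by exact_mod_cast hd
  have hpos : (0 : ℝ) < d - 1 := by linarith
  rw [← add_div, ← sub_div] at h₀ h₁ ⊢
  rw [le_div_iff₀ hpos, zero_mul] at h₀
  rw [div_le_one hpos] at h₁
  have hm : m ≤ k + l := by
    have : (m : ℝ) ≤ k + l := by linarith
    exact_mod_cast this
  have hlt : k + l + 1 ≤ d + m := by
    have : (k : ℝ) + l + 1 ≤ d + m := by linarith
    exact_mod_cast this
  exact ⟨k + l - m, by omega, by rw [Nat.cast_sub hm, Nat.cast_add]⟩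

theorem f1_mem_Ld {d : ℕ} (hd : 2 ≤ d) {a b c : ℝ} (ha : a ∈ Ld d) (hb : b ∈ Ld d)
    (hc : c ∈ Ld d) :
    (f1 (a, b, c)).1 ∈ Ld d ∧ (f1 (a, b, c)).2.1 ∈ Ld d ∧ (f1 (a, b, c)).2.2 ∈ Ld d := by
  have h0 := zero_mem_Ld hd
  have h1 := one_mem_Ld hd
  obtain ⟨ha₀, ha₁⟩ := Ld_subset_Icc hd ha
  obtain ⟨hb₀, hb₁⟩ := Ld_subset_Icc hd hb
  obtain ⟨hc₀, hc₁⟩ := Ld_subset_Icc hd hc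
  have h_one_sub_add : c < a → 1 - a + c ∈ Ld d := fun h => by
    have := add_sub_mem_Ld hd h1 hc ha (by linarith) (by linarith)
    rwa [add_sub_right_comm] at this
  have h_add_sub_one : 1 ≤ c + a → c + a - 1 ∈ Ld d := fun h =>
    add_sub_mem_Ld hd hc ha h1 (by linarith) (by linarith)
  have h_sub : a < b → b - a ∈ Ld d := fun h => by
    have := add_sub_mem_Ld hd hb h0 ha (by linarith) (by linarith)
    rwa [add_zero] at this
  have h_add : c + a < 1 → c + a ∈ Ld d := fun h => by
    have := add_sub_mem_Ld hd hc ha h0 (by linarith) (by linarith)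
    rwa [sub_zero] at this
  unfold f1
  dsimp only
  split_ifs <;> grind

theorem stmt_11 (d : ℕ) (hd : 2 ≤ d) :
    (∀ x : ℝ × ℝ × ℝ, x.1 ∈ Ld d → x.2.1 ∈ Ld d → x.2.2 ∈ Ld d →
      f1 (f1 x) = x) ∧
    Set.BijOn f1 {x : ℝ × ℝ × ℝ | x.1 ∈ Ld d ∧ x.2.1 ∈ Ld d ∧ x.2.2 ∈ Ld d}
      {x : ℝ × ℝ × ℝ | x.1 ∈ Ld d ∧ x.2.1 ∈ Ld d ∧ x.2.2 ∈ Ld d} := by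
  have hinv : ∀ x : ℝ × ℝ × ℝ, x.1 ∈ Ld d → x.2.1 ∈ Ld d → x.2.2 ∈ Ld d → f1 (f1 x) = x :=
    fun _ ha hb hc =>
      f1_f1_of_mem_Icc (Ld_subset_Icc hd ha) (Ld_subset_Icc hd hb) (Ld_subset_Icc hd hc)
  have hmaps : Set.MapsTo f1 {x : ℝ × ℝ × ℝ | x.1 ∈ Ld d ∧ x.2.1 ∈ Ld d ∧ x.2.2 ∈ Ld d}
      {x : ℝ × ℝ × ℝ | x.1 ∈ Ld d ∧ x.2.1 ∈ Ld d ∧ x.2.2 ∈ Ld d} :=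
    fun _ hx => f1_mem_Ld hd hx.1 hx.2.1 hx.2.2
  have hleft : Set.LeftInvOn f1 f1
      {x : ℝ × ℝ × ℝ | x.1 ∈ Ld d ∧ x.2.1 ∈ Ld d ∧ x.2.2 ∈ Ld d} :=
    fun x hx => hinv x hx.1 hx.2.1 hx.2.2
  exact ⟨hinv, Set.InvOn.bijOn ⟨hleft, hleft⟩ hmaps hmaps⟩
end

section
/- Fix an integer d ≥ 2, let L_d = {0, 1/(d−1), …, 1}, and let f¹_d : L_d^3 → L_d^3 be defined by the first applicable of the following rules: i) (x₁,x₃,x₂) if x₁ = 0 and x₂ ≠ x₃; ii) (x₁,x₃,x₂) if 0 < x₁ ≤ x₃ < 1 and x₂ = 1; iii) (x₁,x₃,x₂) if 0 < x₁ ≤ x₂ < 1 and x₃ = 1; iv) (x₁,x₁,1−x₁+x₃) if x₃ < x₁ < 1 and x₂ = 1; v) (x₁,1,x₃+x₁−1) if x₁ < 1, x₂ = x₁, x₃+x₁ ≥ 1 and x₃ < 1; vi) (x₁,x₁,x₂−x₁) if 0 < x₁ < x₂ < 1 and x₃ = 0; vii) (x₁,x₃+x₁,0) if 0 < x₁, x₂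 = x₁, x₃+x₁ < 1 and x₃ > 0; viii) (x₁,x₂,x₃) otherwise. Then f¹_d realizes in its configurations the Łukasiewicz connectives and FAN-OUT: for all a, b ∈ L_d, (1) the third component of f¹_d(a,1,b) equals a →_L b = min(1, 1−a+b); (2) the second component of f¹_d(a,1,b) equals a ∨ b = max(a,b); (3) the second component of f¹_d(a,b,0) equals a ∧ b = min(a,b); and (4) the first and second components of f¹_d(a,1,0) both equal a (FAN-OUT). -/
/-- Every truth value in `L_d` lies in the unit interval. -/
theorem mem_Icc_of_mem_Ld_s14 {d : ℕ} (hd : 2 ≤ d) {a : ℝ} (ha : a ∈ Ld d) :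
    0 ≤ a ∧ a ≤ 1 := by
  obtain ⟨k, hk, rfl⟩ := Finset.mem_image.mp ha
  have hd' : (2 : ℝ) ≤ d := by exact_mod_cast hd
  have hk' : (k : ℝ) + 1 ≤ d := by exact_mod_cast Finset.mem_range.mp hk
  have hpos : (0 : ℝ) < d - 1 := by linarith
  exact ⟨by positivity, (div_le_one hpos).mpr (by linarith)⟩

theorem f1_one_snd_snd {a b : ℝ} (ha : 0 ≤ a ∧ a ≤ 1) (hb : 0 ≤ b ∧ b ≤ 1) :
    (f1 (a, 1, b)).2.2 = min 1 (1 - a + b) := by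
  simp only [f1]
  grind

theorem f1_one_snd_fst {a b : ℝ} (ha : 0 ≤ a ∧ a ≤ 1) (hb : 0 ≤ b ∧ b ≤ 1) :
    (f1 (a, 1, b)).2.1 = max a b := by
  simp only [f1]
  grind

theorem f1_zero_snd_fst {a b : ℝ} (ha : 0 ≤ a ∧ a ≤ 1) (hb : 0 ≤ b ∧ b ≤ 1) :
    (f1 (a, b, 0)).2.1 = min a b := by
  simp only [f1]
  split_ifs <;> grind

theorem f1_fst (x : ℝ × ℝ × ℝ) : (f1 x).1 = x.1 := by
  simp only [f1]
  split_ifs <;> rfl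

theorem stmt_14 (d : ℕ) (hd : 2 ≤ d) :
    (∀ a ∈ Ld d, ∀ b ∈ Ld d, (f1 (a, 1, b)).2.2 = min 1 (1 - a + b)) ∧
    (∀ a ∈ Ld d, ∀ b ∈ Ld d, (f1 (a, 1, b)).2.1 = max a b) ∧
    (∀ a ∈ Ld d, ∀ b ∈ Ld d, (f1 (a, b, 0)).2.1 = min a b) ∧
    (∀ a ∈ Ld d, (f1 (a, 1, 0)).1 = a ∧ (f1 (a, 1, 0)).2.1 = a) := by
  refine ⟨fun a ha b hb => ?_, fun a ha b hb => ?_, fun a ha b hb => ?_, fun a ha => ?_⟩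
  · exact f1_one_snd_snd (mem_Icc_of_mem_Ld_s14 hd ha) (mem_Icc_of_mem_Ld_s14 hd hb)
  · exact f1_one_snd_fst (mem_Icc_of_mem_Ld_s14 hd ha) (mem_Icc_of_mem_Ld_s14 hd hb)
  · exact f1_zero_snd_fst (mem_Icc_of_mem_Ld_s14 hd ha) (mem_Icc_of_mem_Ld_s14 hd hb)
  · have h := mem_Icc_of_mem_Ld_s14 hd ha
    exact ⟨f1_fst _, (f1_one_snd_fst h ⟨le_rfl, zero_le_one⟩).trans (max_eq_left h.1)⟩
end

section
/- Fix an integer d ≥ 2, let L_d = {0, 1/(d−1), …, 1}, and let m_d : L_d^3 → L_d^3 be defined by the first applicable of the following rules: i) (x₁,x₃,x₂) if x₁ = 0 and x₂ ≠ x₃; ii) (x₁,x₁+x₃,1−x₁) if x₁ > 0, x₂ = 1 and x₁+x₃ < 1; iii) (x₁,1,x₂−x₁) if 0 < x₁ ≤ x₂ < 1 and x₃ = 1−x₁; iv) (x₁,x₁+x₂−1,1−x₁) if x₁ < 1, x₂ < 1, x₃ = 0 and x₁+x₂ > 1; v) (x₁,x₂+x₃,0) if 0 < x₂ < x₁ <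 1 and x₃ = 1−x₁; vi) (x₁,x₃,x₂) if 0 < x₁, x₂ > 0, x₃ = 0 and x₁+x₂ ≤ 1; vii) (x₁,x₃,x₂) if 0 < x₁, x₂ = 0, x₃ > 0 and x₁+x₃ ≤ 1; viii) (x₁,x₂,x₃) otherwise. Then m_d is self-reversible: m_d(m_d(x)) = x for every x ∈ L_d^3 (in particular, m_d is a bijection of L_d^3). -/
/-- The gate `m_d`, defined by the first applicable of rules i) – viii). -/
noncomputable def md (x : ℝ × ℝ × ℝ) : ℝ × ℝ × ℝ :=
  let x₁ := x.1; let x₂ := x.2.1; let x₃ := x.2.2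
  if x₁ = 0 ∧ x₂ ≠ x₃ then (x₁, x₃, x₂)                                           -- i)
  else if 0 < x₁ ∧ x₂ = 1 ∧ x₁ + x₃ < 1 then (x₁, x₁ + x₃, 1 - x₁)                -- ii)
  else if 0 < x₁ ∧ x₁ ≤ x₂ ∧ x₂ < 1 ∧ x₃ = 1 - x₁ then (x₁, 1, x₂ - x₁)           -- iii)
  else if x₁ < 1 ∧ x₂ < 1 ∧ x₃ = 0 ∧ 1 < x₁ + x₂ then (x₁, x₁ + x₂ - 1, 1 - x₁)   -- iv)
  else if 0 < x₂ ∧ x₂ < x₁ ∧ x₁ < 1 ∧ x₃ = 1 - x₁ then (x₁, x₂ + x₃, 0)           -- v)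
  else if 0 < x₁ ∧ 0 < x₂ ∧ x₃ = 0 ∧ x₁ + x₂ ≤ 1 then (x₁, x₃, x₂)                -- vi)
  else if 0 < x₁ ∧ x₂ = 0 ∧ 0 < x₃ ∧ x₁ + x₃ ≤ 1 then (x₁, x₃, x₂)                -- vii)
  else (x₁, x₂, x₃)                                                                -- viii)

theorem mem_Ld_iff {d : ℕ} {a : ℝ} :
    a ∈ Ld d ↔ ∃ k : ℕ, k < d ∧ (k : ℝ) / ((d : ℝ) - 1) = a := by
  simp [Ld]

theorem natCast_sub_one_pos {d : ℕ} (hd : 2 ≤ d) : (0 : ℝ) < (d : ℝ) - 1 := by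
  have : (2 : ℝ) ≤ d := by exact_mod_cast hd
  linarith

theorem Ld_nonneg {d : ℕ} (hd : 2 ≤ d) {a : ℝ} (ha : a ∈ Ld d) : 0 ≤ a := by
  obtain ⟨k, -, rfl⟩ := mem_Ld_iff.1 ha
  exact div_nonneg k.cast_nonneg (natCast_sub_one_pos hd).le

theorem Ld_le_one {d : ℕ} (hd : 2 ≤ d) {a : ℝ} (ha : a ∈ Ld d) : a ≤ 1 := by
  obtain ⟨k, hk, rfl⟩ := mem_Ld_iff.1 ha
  rw [div_le_one (natCast_sub_one_pos hd)]
  have : (k : ℝ) + 1 ≤ d := by exact_mod_cast hk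
  linarith

theorem sub_mem_Ld {d : ℕ} (hd : 2 ≤ d) {a b : ℝ} (ha : a ∈ Ld d) (hb : b ∈ Ld d)
    (hba : b ≤ a) : a - b ∈ Ld d := by
  obtain ⟨k, hk, rfl⟩ := mem_Ld_iff.1 ha
  obtain ⟨l, hl, rfl⟩ := mem_Ld_iff.1 hb
  have hlk : l ≤ k := by
    exact_mod_cast (div_le_div_iff_of_pos_right (natCast_sub_one_pos hd)).1 hba
  exact mem_Ld_iff.2 ⟨k - l, by omega, by rw [Nat.cast_sub hlk, sub_div]⟩

theorem one_sub_mem_Ld {d : ℕ} (hd : 2 ≤ d) {a : ℝ} (ha : a ∈ Ld d) : 1 - a ∈ Ld d :=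
  sub_mem_Ld hd (one_mem_Ld hd) ha (Ld_le_one hd ha)

theorem add_mem_Ld {d : ℕ} (hd : 2 ≤ d) {a b : ℝ} (ha : a ∈ Ld d) (hb : b ∈ Ld d)
    (hab : a + b ≤ 1) : a + b ∈ Ld d := by
  have h := one_sub_mem_Ld hd (sub_mem_Ld hd (one_sub_mem_Ld hd ha) hb (by linarith))
  rwa [show 1 - (1 - a - b) = a + b by ring] at h

theorem add_sub_one_mem_Ld {d : ℕ} (hd : 2 ≤ d) {a b : ℝ} (ha : a ∈ Ld d) (hb : b ∈ Ld d)
    (hab : 1 ≤ a + b) : a + b - 1 ∈ Ld d := by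
  have h := sub_mem_Ld hd ha (one_sub_mem_Ld hd hb) (by linarith)
  rwa [show a - (1 - b) = a + b - 1 by ring] at h

theorem md_md_of_nonneg {a b c : ℝ} (hb : 0 ≤ b) (hc : 0 ≤ c) :
    md (md (a, b, c)) = (a, b, c) := by
  generalize h : md (a, b, c) = y
  simp only [md] at h
  split_ifs at h <;> subst h <;> simp only [md] <;> grind

theorem md_mem {d : ℕ} (hd : 2 ≤ d) {x : ℝ × ℝ × ℝ}
    (hx : x.1 ∈ Ld d ∧ x.2.1 ∈ Ld d ∧ x.2.2 ∈ Ld d) :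
    (md x).1 ∈ Ld d ∧ (md x).2.1 ∈ Ld d ∧ (md x).2.2 ∈ Ld d := by
  obtain ⟨a, b, c⟩ := x
  obtain ⟨ha, hb, hc⟩ := hx
  dsimp only at ha hb hc
  simp only [md]
  split_ifs with h₁ h₂ h₃ h₄ h₅ h₆ h₇
  · exact ⟨ha, hc, hb⟩
  · exact ⟨ha, add_mem_Ld hd ha hc h₂.2.2.le, one_sub_mem_Ld hd ha⟩
  · exact ⟨ha, one_mem_Ld hd, sub_mem_Ld hd hb ha h₃.2.1⟩
  · exact ⟨ha, add_sub_one_mem_Ld hd ha hb h₄.2.2.2.le, one_sub_mem_Ld hd ha⟩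
  · exact ⟨ha, add_mem_Ld hd hb hc (by linarith), zero_mem_Ld hd⟩
  · exact ⟨ha, hc, hb⟩
  · exact ⟨ha, hc, hb⟩
  · exact ⟨ha, hb, hc⟩

theorem stmt_17 (d : ℕ) (hd : 2 ≤ d) :
    (∀ x : ℝ × ℝ × ℝ, x.1 ∈ Ld d → x.2.1 ∈ Ld d → x.2.2 ∈ Ld d →
      md (md x) = x) ∧
    Set.BijOn md {x : ℝ × ℝ × ℝ | x.1 ∈ Ld d ∧ x.2.1 ∈ Ld d ∧ x.2.2 ∈ Ld d}
      {x : ℝ × ℝ × ℝ | x.1 ∈ Ld d ∧ x.2.1 ∈ Ld d ∧ x.2.2 ∈ Ld d} := by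
  have hinv : ∀ x : ℝ × ℝ × ℝ, x.1 ∈ Ld d → x.2.1 ∈ Ld d → x.2.2 ∈ Ld d → md (md x) = x :=
    fun _ _ h₂ h₃ => md_md_of_nonneg (Ld_nonneg hd h₂) (Ld_nonneg hd h₃)
  have hmaps : Set.MapsTo md {x : ℝ × ℝ × ℝ | x.1 ∈ Ld d ∧ x.2.1 ∈ Ld d ∧ x.2.2 ∈ Ld d}
      {x : ℝ × ℝ × ℝ | x.1 ∈ Ld d ∧ x.2.1 ∈ Ld d ∧ x.2.2 ∈ Ld d} := fun x hx => md_mem hd hx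
  exact ⟨hinv, Set.InvOn.bijOn ⟨fun x hx => hinv x hx.1 hx.2.1 hx.2.2,
    fun x hx => hinv x hx.1 hx.2.1 hx.2.2⟩ hmaps hmaps⟩
end
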